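/- arXiv:2103.07400 — 3 statements merged into one kernel-verified Lean document; each statement's English description precedes it below -/
import Mathlib

section
/- Let n,m ≥ 1, L,β,γ > 0, and ε,ε′ ∈ ℝ; set q = e^{−2πβ/L} and t = e^{−2πγ/L}. Let u ∈ ℂ^n with Im u_i = ε for all i and v ∈ ℂ^m with Im v_j = ε′ for all j, and set x_i = e^{2πi u_i/L}, y_j = e^{2πi v_j/L}. Assume sin(π(u_i−v_j+i(γ−β)/2)/L) ≠ 0 and sin(π(u_i−v_j−i(γ−β)/2)/L) ≠ 0 for all i,j. Then Δ_{n,m}(x,y;q,t) = exp(nmπ(γ−β)/L) · Ψ_0(u,v;β,γ) · conj(Ψ_0(conj(u),conj(v);β,γ)), where conj applied to a vector means entrywise complex conjugation. -/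
open Complex MeasureTheory Finset

noncomputable section

/-- The infinite q-Pochhammer symbol `(a;q)_∞`. -/
def qPochInf (a q : ℂ) : ℂ := ∏' k : ℕ, (1 - a * q ^ k)

/-- The weight function `Δ_N(z;q,t)`. -/
def DeltaW {N : ℕ} (q t : ℂ) (z : Fin N → ℂ) : ℂ :=
  ∏ i : Fin N, ∏ j : Fin N,
    if i ≠ j then qPochInf (z i / z j) q / qPochInf (t * (z i / z j)) q else 1

/-- The weight function `Δ_{n,m}(x,y;q,t)` for real parameters `0 < q,t < 1`. -/
def DeltaNM (n m : ℕ) (q t : ℝ) (x : Fin n → ℂ) (y : Fin m → ℂ) : ℂ :=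
  DeltaW (q : ℂ) (t : ℂ) x * DeltaW (t : ℂ) (q : ℂ) y /
    ∏ i : Fin n, ∏ j : Fin m,
      ((1 - (Real.sqrt q : ℂ)⁻¹ * (Real.sqrt t : ℂ) * (x i / y j)) *
        (1 - (Real.sqrt q : ℂ)⁻¹ * (Real.sqrt t : ℂ) * (y j / x i)))

/-- The trigonometric Gamma function `G(r,a;z)`. -/
def trigGamma (r a : ℝ) (z : ℂ) : ℂ :=
  ∏' k : ℕ,
    (1 - Complex.exp (2 * Complex.I * (r : ℂ) * (z + Complex.I * (a : ℂ) * (k : ℂ) + Complex.I * (a : ℂ) / 2)))⁻¹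

/-- The weight function `w(r,a,b;z)`. -/
def wFun (r a b : ℝ) (z : ℂ) : ℂ :=
  trigGamma r a (z + Complex.I * (b : ℂ) - Complex.I * (a : ℂ) / 2) *
      trigGamma r a (-z + Complex.I * (b : ℂ) - Complex.I * (a : ℂ) / 2) /
    (trigGamma r a (z - Complex.I * (a : ℂ) / 2) * trigGamma r a (-z - Complex.I * (a : ℂ) / 2))

/-- The (formal) groundstate wave function `Ψ₀(u,v;β,γ)`; the square roots of the products of
`w`-factors (which are nonnegative real for real arguments) are taken as nonnegative real
square roots. -/
def Psi0 (n m : ℕ) (L β γ : ℝ) (u : Fin n → ℂ) (v : Fin m → ℂ) : ℂ :=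
  ((Real.sqrt (∏ i : Fin n, ∏ j : Fin n,
      if i < j then (wFun (Real.pi / L) β γ (u i - u j)).re else 1) : ℝ) : ℂ) *
    ((Real.sqrt (∏ i : Fin m, ∏ j : Fin m,
      if i < j then (wFun (Real.pi / L) γ β (v i - v j)).re else 1) : ℝ) : ℂ) /
    ∏ i : Fin n, ∏ j : Fin m,
      (2 * Complex.sin ((Real.pi : ℂ) * (u i - v j + Complex.I * (γ : ℂ) / 2 - Complex.I * (β : ℂ) / 2) / (L : ℂ)))

lemma norm_ofReal_exp_neg_lt_one {c : ℝ} (hc : 0 < c) : ‖((Real.exp (-c) : ℝ) : ℂ)‖ < 1 := by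
  rw [Complex.norm_real, Real.norm_eq_abs, abs_of_pos (Real.exp_pos _)]
  simpa using hc

lemma summable_norm_mul_pow (a : ℂ) {q : ℂ} (hq : ‖q‖ < 1) :
    Summable fun k : ℕ => ‖-(a * q ^ k)‖ := by
  simp only [norm_neg, norm_mul, norm_pow]
  exact (summable_geometric_of_lt_one (norm_nonneg _) hq).mul_left _

lemma multipliable_one_sub_mul_pow (a : ℂ) {q : ℂ} (hq : ‖q‖ < 1) :
    Multipliable fun k : ℕ => 1 - a * q ^ k := by
  simpa only [sub_eq_add_neg] using
    multipliable_one_add_of_summable (summable_norm_mul_pow a hq)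

lemma tprod_inv_one_sub_mul_pow (a : ℂ) {q : ℂ} (hq : ‖q‖ < 1) :
    ∏' k : ℕ, (1 - a * q ^ k)⁻¹ = (qPochInf a q)⁻¹ := by
  unfold qPochInf
  by_cases h : ∃ k : ℕ, 1 - a * q ^ k = 0
  · obtain ⟨k, hk⟩ := h
    have hk' : (1 - a * q ^ k)⁻¹ = 0 := by rw [hk, inv_zero]
    rw [tprod_of_exists_eq_zero ⟨k, hk'⟩, tprod_of_exists_eq_zero ⟨k, hk⟩, inv_zero]
  · push Not at h
    have hne : ∏' k : ℕ, (1 - a * q ^ k) ≠ 0 := by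
      simpa only [sub_eq_add_neg] using
        tprod_one_add_ne_zero_of_summable (by simpa only [sub_eq_add_neg] using h)
          (summable_norm_mul_pow a hq)
    exact ((multipliable_one_sub_mul_pow a hq).hasProd.inv₀ hne).tprod_eq

lemma conj_qPochInf (a : ℂ) {q : ℂ} (hq : ‖q‖ < 1) :
    starRingEnd ℂ (qPochInf a q) = qPochInf (starRingEnd ℂ a) (starRingEnd ℂ q) := by
  unfold qPochInf
  rw [(multipliable_one_sub_mul_pow a hq).map_tprod (starRingEnd ℂ) Complex.continuous_conj]
  simp

lemma trigGamma_sub_half {r a : ℝ} (hr : 0 < r) (ha : 0 < a) (z : ℂ) :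
    trigGamma r a (z - I * (a : ℂ) / 2) =
      (qPochInf (exp (2 * I * r * z)) (Real.exp (-(2 * r * a)) : ℝ))⁻¹ := by
  rw [← tprod_inv_one_sub_mul_pow _ (norm_ofReal_exp_neg_lt_one (by positivity))]
  unfold trigGamma
  congr 1
  ext k
  rw [ofReal_exp, ← Complex.exp_nat_mul, ← Complex.exp_add]
  congr 3
  push_cast
  linear_combination (2 * (r : ℂ) * a * k) * I_sq

lemma wFun_eq {r a b : ℝ} (hr : 0 < r) (ha : 0 < a) (z : ℂ) :
    wFun r a b z =
      qPochInf (exp (2 * I * r * z)) (Real.exp (-(2 * r * a)) : ℝ) /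
          qPochInf ((Real.exp (-(2 * r * b)) : ℝ) * exp (2 * I * r * z))
            (Real.exp (-(2 * r * a)) : ℝ) *
        (qPochInf (exp (2 * I * r * -z)) (Real.exp (-(2 * r * a)) : ℝ) /
          qPochInf ((Real.exp (-(2 * r * b)) : ℝ) * exp (2 * I * r * -z))
            (Real.exp (-(2 * r * a)) : ℝ)) := by
  have h (z : ℂ) : exp (2 * I * r * (z + I * b)) =
      (Real.exp (-(2 * r * b)) : ℝ) * exp (2 * I * r * z) := by
    rw [ofReal_exp, ← Complex.exp_add]
    congr 1
    push_cast
    linear_combination (2 * (r : ℂ) * b) * I_sq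
  rw [wFun]
  simp only [trigGamma_sub_half hr ha, h]
  simp only [div_eq_mul_inv, mul_inv, inv_inv]
  ring

lemma wFun_ofReal {r a b : ℝ} (hr : 0 < r) (ha : 0 < a) {z : ℂ} (hz : z.im = 0) :
    0 ≤ (wFun r a b z).re ∧ ((wFun r a b z).re : ℂ) = wFun r a b z := by
  have hzc : starRingEnd ℂ z = z := conj_eq_iff_im.2 hz
  have hq : ‖((Real.exp (-(2 * r * a)) : ℝ) : ℂ)‖ < 1 :=
    norm_ofReal_exp_neg_lt_one (by positivity)
  have hX : exp (2 * I * r * -z) = starRingEnd ℂ (exp (2 * I * r * z)) := by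
    rw [← exp_conj]
    congr 1
    simp [hzc, -mul_eq_mul_left_iff, -mul_eq_mul_right_iff, map_ofNat]
  have h : wFun r a b z = (normSq (qPochInf (exp (2 * I * r * z)) (Real.exp (-(2 * r * a)) : ℝ) /
          qPochInf ((Real.exp (-(2 * r * b)) : ℝ) * exp (2 * I * r * z))
            (Real.exp (-(2 * r * a)) : ℝ)) : ℝ) := by
    rw [wFun_eq hr ha, ← mul_conj, map_div₀, conj_qPochInf _ hq, conj_qPochInf _ hq, map_mul,
      conj_ofReal, conj_ofReal, hX]
  rw [h, ofReal_re]
  exact ⟨normSq_nonneg _, rfl⟩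

lemma prod_prod_ite_ne {ι M : Type*} [Fintype ι] [LinearOrder ι] [CommMonoid M]
    (f : ι → ι → M) :
    (∏ i, ∏ j, if i ≠ j then f i j else 1) = ∏ i, ∏ j, if i < j then f i j * f j i else 1 := by
  have h1 (i j : ι) : (if i ≠ j then f i j else 1) =
      (if i < j then f i j else 1) * (if j < i then f i j else 1) := by
    rcases lt_trichotomy i j with h | h | h
    · simp [h, h.ne, h.not_gt]
    · simp [h]
    · simp [h, h.ne', h.not_gt]
  have h2 (i j : ι) : (if i < j then f i j * f j i else 1) =
      (if i < j then f i j else 1) * (if i < j then f j i else 1) := by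
    split_ifs <;> simp
  simp only [h1, h2, prod_mul_distrib]
  rw [Finset.prod_comm (f := fun i j => if j < i then f i j else 1)]

lemma prod_wFun_re_nonneg {N : ℕ} {r a b : ℝ} (hr : 0 < r) (ha : 0 < a) {z : Fin N → ℂ}
    (hz : ∀ i j, (z i - z j).im = 0) :
    0 ≤ ∏ i, ∏ j, if i < j then (wFun r a b (z i - z j)).re else 1 := by
  refine prod_nonneg fun i _ => prod_nonneg fun j _ => ?_
  split_ifs
  · exact (wFun_ofReal hr ha (hz i j)).1
  · exact zero_le_one

lemma DeltaW_exp {N : ℕ} {r a b : ℝ} (hr : 0 < r) (ha : 0 < a) {z : Fin N → ℂ}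
    (hz : ∀ i j, (z i - z j).im = 0) :
    DeltaW (Real.exp (-(2 * r * a)) : ℝ) (Real.exp (-(2 * r * b)) : ℝ)
        (fun i => exp (2 * I * r * z i)) =
      ((∏ i, ∏ j, if i < j then (wFun r a b (z i - z j)).re else 1 : ℝ) : ℂ) := by
  rw [DeltaW, prod_prod_ite_ne]
  push_cast
  refine prod_congr rfl fun i _ => prod_congr rfl fun j _ => ?_
  split_ifs
  · rw [(wFun_ofReal hr ha (hz i j)).2, wFun_eq hr ha]
    have h (i j : Fin N) : exp (2 * I * r * z i) / exp (2 * I * r * z j) =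
        exp (2 * I * r * (z i - z j)) := by
      rw [← Complex.exp_sub, mul_sub]
    rw [h, h, neg_sub]
    push_cast
    rfl
  · simp

lemma one_sub_exp_mul_one_sub_exp (θ θ' : ℂ) :
    (1 - exp (2 * I * θ)) * (1 - exp (-(2 * I * θ'))) =
      exp (I * (θ - θ')) * ((2 * sin θ) * (2 * sin θ')) := by
  have h1 : exp (2 * I * θ) = exp (I * θ) ^ 2 := by
    rw [← Complex.exp_nat_mul]; congr 1; push_cast; ring
  have h2 : exp (-(2 * I * θ')) = (exp (I * θ') ^ 2)⁻¹ := by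
    rw [← Complex.exp_nat_mul, ← Complex.exp_neg]; congr 1; push_cast; ring
  have h3 : exp (I * (θ - θ')) = exp (I * θ) * (exp (I * θ'))⁻¹ := by
    rw [← Complex.exp_neg, ← Complex.exp_add]; congr 1; ring
  have h4 (θ : ℂ) : 2 * sin θ = ((exp (I * θ))⁻¹ - exp (I * θ)) * I := by
    rw [two_sin, neg_mul, Complex.exp_neg, mul_comm θ I]
  rw [h1, h2, h3, h4, h4]
  have e1 := Complex.exp_ne_zero (I * θ)
  have e2 := Complex.exp_ne_zero (I * θ')
  field_simp
  rw [I_sq]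
  ring

lemma sqrt_exp_inv_mul_sqrt_exp (b c : ℝ) :
    (√(Real.exp b))⁻¹ * √(Real.exp c) = Real.exp ((c - b) / 2) := by
  rw [Real.exp_half, sub_eq_add_neg, Real.exp_add, Real.exp_neg, Real.sqrt_mul (Real.exp_nonneg _),
    Real.sqrt_inv, mul_comm]

lemma deltaNM_denominator_factor (L β γ : ℝ) (s s' : ℂ) :
    (1 - (√(Real.exp (-2 * Real.pi * β / L)) : ℂ)⁻¹ * (√(Real.exp (-2 * Real.pi * γ / L)) : ℂ) *
          (exp (2 * Real.pi * I * s / L) / exp (2 * Real.pi * I * s' / L))) *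
        (1 - (√(Real.exp (-2 * Real.pi * β / L)) : ℂ)⁻¹ * (√(Real.exp (-2 * Real.pi * γ / L)) : ℂ) *
          (exp (2 * Real.pi * I * s' / L) / exp (2 * Real.pi * I * s / L))) =
      (Real.exp (Real.pi * (γ - β) / L) : ℂ)⁻¹ *
        ((2 * sin (Real.pi * (s - s' + I * γ / 2 - I * β / 2) / L)) *
          starRingEnd ℂ (2 * sin (Real.pi * (starRingEnd ℂ s - starRingEnd ℂ s' + I * γ / 2 -
            I * β / 2) / L))) := by
  have hc : (√(Real.exp (-2 * Real.pi * β / L)) : ℂ)⁻¹ * (√(Real.exp (-2 * Real.pi * γ / L)) : ℂ) =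
      exp (Real.pi * (β - γ) / L) := by
    rw [← ofReal_inv, ← ofReal_mul, sqrt_exp_inv_mul_sqrt_exp, ofReal_exp]
    congr 1
    push_cast
    ring
  have hconj : starRingEnd ℂ (2 * sin (Real.pi * (starRingEnd ℂ s - starRingEnd ℂ s' + I * γ / 2 -
      I * β / 2) / L)) = 2 * sin (Real.pi * (s - s' - I * γ / 2 + I * β / 2) / L) := by
    rw [map_mul, ← sin_conj]
    simp only [map_div₀, map_mul, map_add, map_sub, conj_ofReal, conj_I, conj_conj,
      map_ofNat]
    ring_nf
  rw [hc, hconj, ofReal_exp, ← Complex.exp_neg, ← Complex.exp_sub, ← Complex.exp_sub,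
    ← Complex.exp_add, ← Complex.exp_add]
  convert one_sub_exp_mul_one_sub_exp (Real.pi * (s - s' + I * γ / 2 - I * β / 2) / L)
    (Real.pi * (s - s' - I * γ / 2 + I * β / 2) / L) using 4
  · linear_combination (Real.pi * (β - γ) / L : ℂ) * I_sq
  · linear_combination (Real.pi * (β - γ) / L : ℂ) * I_sq
  · push_cast
    linear_combination (Real.pi * (β - γ) / L : ℂ) * I_sq

theorem statement5 (n m : ℕ) (hn : 1 ≤ n) (hm : 1 ≤ m) (L β γ : ℝ)
    (hL : 0 < L) (hβ : 0 < β) (hγ : 0 < γ) (ε ε' : ℝ)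
    (u : Fin n → ℂ) (v : Fin m → ℂ)
    (hu : ∀ i, (u i).im = ε) (hv : ∀ j, (v j).im = ε')
    (hsin : ∀ (i : Fin n) (j : Fin m),
      Complex.sin ((Real.pi : ℂ) * (u i - v j + Complex.I * ((γ : ℂ) - (β : ℂ)) / 2) / (L : ℂ)) ≠ 0 ∧
        Complex.sin ((Real.pi : ℂ) * (u i - v j - Complex.I * ((γ : ℂ) - (β : ℂ)) / 2) / (L : ℂ)) ≠ 0) :
    DeltaNM n m (Real.exp (-2 * Real.pi * β / L)) (Real.exp (-2 * Real.pi * γ / L))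
        (fun i => Complex.exp (2 * (Real.pi : ℂ) * Complex.I * u i / (L : ℂ)))
        (fun j => Complex.exp (2 * (Real.pi : ℂ) * Complex.I * v j / (L : ℂ))) =
      (Real.exp (n * m * Real.pi * (γ - β) / L) : ℂ) * Psi0 n m L β γ u v *
        starRingEnd ℂ (Psi0 n m L β γ
          (fun i => starRingEnd ℂ (u i)) (fun j => starRingEnd ℂ (v j))) := by
  have hr : 0 < Real.pi / L := div_pos Real.pi_pos hL
  have hu' (i j : Fin n) : (u i - u j).im = 0 := by simp [hu]
  have hv' (i j : Fin m) : (v i - v j).im = 0 := by simp [hv]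
  have conj_sub_conj {z w : ℂ} (h : (z - w).im = 0) :
      starRingEnd ℂ z - starRingEnd ℂ w = z - w := by
    rw [← map_sub, conj_eq_iff_im.2 h]
  have hexp (b : ℝ) : Real.exp (-2 * Real.pi * b / L) = Real.exp (-(2 * (Real.pi / L) * b)) := by
    congr 1
    ring
  have harg (s : ℂ) : Complex.exp (2 * (Real.pi : ℂ) * Complex.I * s / (L : ℂ)) =
      Complex.exp (2 * Complex.I * ((Real.pi / L : ℝ) : ℂ) * s) := by
    congr 1
    push_cast
    ring
  have hx := DeltaW_exp (b := γ) hr hβ hu'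
  have hy := DeltaW_exp (b := β) hr hγ hv'
  simp only [← hexp, ← harg] at hx hy
  have hpow : Complex.exp (n * m * Real.pi * (γ - β) / L) =
      ((Complex.exp (Real.pi * (γ - β) / L)) ^ m) ^ n := by
    rw [← pow_mul, ← Complex.exp_nat_mul]
    congr 1
    push_cast
    ring
  rw [DeltaNM, hx, hy, Psi0, Psi0]
  simp only [deltaNM_denominator_factor, prod_mul_distrib, prod_const, card_univ, Fintype.card_fin,
    conj_sub_conj (hu' _ _), conj_sub_conj (hv' _ _), map_div₀, map_mul, map_prod, map_pow, conj_ofReal,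
    ofReal_exp, ofReal_mul, ofReal_div, ofReal_sub, ofReal_natCast, hpow]
  rw [← Real.mul_self_sqrt (prod_wFun_re_nonneg (b := γ) hr hβ hu'),
    ← Real.mul_self_sqrt (prod_wFun_re_nonneg (b := β) hr hγ hv')]
  simp only [Real.sqrt_mul_self (Real.sqrt_nonneg _), ofReal_mul]
  simp only [div_eq_mul_inv, mul_inv, inv_pow, inv_inv]
  ring
end
end

section
/- Let n,m ≥ 0 be integers, 0 < q < 1, 0 < t < 1. For every function f : (0,∞)^n×(0,∞)^m → ℂ and every point (x,y) ∈ (0,∞)^n×(0,∞)^m at which all denominators appearing in the coefficients A_i(x,y;q,t), B_j(x,y;q,t), A_i(x,y;q^{−1},t^{−1}), B_j(x,y;q^{−1},t^{−1}) are nonzero, one has: (M_{n,m;q,t}(Bf))(x,y) − (B(M_{n,m;q,t}f))(x,y) = i · (M_{n,m;q,t}f)(x,y), and (M_{n,m;q^{−1},t^{−1}}(Bf))(x,y) − (B(M_{n,m;q^{−1},t^{−1}}f))(x,y) = −i · (M_{n,m;q^{−1},t^{−1}}f)(x,y), where in both identities B is defined with the original parameters q,t. -/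
open Complex MeasureTheory Finset

noncomputable section

/-- The coefficient `A_i(x,y;Q,T)` for real variables. -/
def AcoefR (n m : ℕ) (Qp Tp : ℝ) (i : Fin n) (x : Fin n → ℝ) (y : Fin m → ℝ) : ℝ :=
  (∏ i' : Fin n, if i' ≠ i then (Tp * x i - x i') / (x i - x i') else 1) *
    ∏ j : Fin m,
      (Real.sqrt Tp * x i - Real.sqrt Qp * y j) /
        (Real.sqrt Tp * x i - (Real.sqrt Qp)⁻¹ * y j)

/-- The coefficient `B_j(x,y;Q,T)` for real variables. -/
def BcoefR (n m : ℕ) (Qp Tp : ℝ) (j : Fin m) (x : Fin n → ℝ) (y : Fin m → ℝ) : ℝ :=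
  (∏ j' : Fin m, if j' ≠ j then (Qp⁻¹ * y j - y j') / (y j - y j') else 1) *
    ∏ i : Fin n,
      ((Real.sqrt Qp)⁻¹ * y j - (Real.sqrt Tp)⁻¹ * x i) /
        ((Real.sqrt Qp)⁻¹ * y j - Real.sqrt Tp * x i)

/-- The deformed Macdonald–Ruijsenaars operator `M_{n,m;Q,T}` (without constant term),
acting on functions of real variables. -/
def MopR (n m : ℕ) (Qp Tp : ℝ) (f : (Fin n → ℝ) → (Fin m → ℝ) → ℂ) :
    (Fin n → ℝ) → (Fin m → ℝ) → ℂ := fun x y =>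
  (Tp : ℂ) ^ ((1 : ℤ) - n) / (1 - (Qp : ℂ)) *
      ∑ i : Fin n, (AcoefR n m Qp Tp i x y : ℂ) * f (Function.update x i (Qp * x i)) y +
    (Qp : ℂ) ^ ((m : ℤ) - 1) / (1 - (Tp : ℂ)⁻¹) *
      ∑ j : Fin m, (BcoefR n m Qp Tp j x y : ℂ) * f x (Function.update y j (Tp⁻¹ * y j))

/-- The boost operator `B`. -/
def BoostOp (n m : ℕ) (q t : ℝ) (f : (Fin n → ℝ) → (Fin m → ℝ) → ℂ) :
    (Fin n → ℝ) → (Fin m → ℝ) → ℂ := fun x y =>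
  (Complex.I * ∑ i : Fin n, ((Real.log (x i) / Real.log q : ℝ) : ℂ) -
      Complex.I * ∑ j : Fin m, ((Real.log (y j) / Real.log t : ℝ) : ℂ)) * f x y

theorem sum_log_div_update_mul {k : ℕ} {a c ε : ℝ} (hc : 0 < c) (hε : Real.log c / Real.log a = ε)
    (z : Fin k → ℝ) (hz : ∀ l, 0 < z l) (i : Fin k) :
    ∑ l, ((Real.log (Function.update z i (c * z i) l) / Real.log a : ℝ) : ℂ) =
      ∑ l, ((Real.log (z l) / Real.log a : ℝ) : ℂ) + ε := by
  rw [← Finset.add_sum_erase _ _ (Finset.mem_univ i),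
    ← Finset.add_sum_erase (a := i) Finset.univ
      (fun l => ((Real.log (z l) / Real.log a : ℝ) : ℂ)) (Finset.mem_univ i),
    Finset.sum_congr rfl fun l hl => by
      rw [Function.update_of_ne (Finset.ne_of_mem_erase hl)],
    Function.update_self, Real.log_mul hc.ne' (hz i).ne', add_div, hε]
  push_cast
  ring

theorem MopR_BoostOp_sub_BoostOp_MopR (n m : ℕ) {q t Q T ε : ℝ} (hQ : 0 < Q) (hT : 0 < T)
    (hQε : Real.log Q / Real.log q = ε) (hTε : Real.log T / Real.log t = ε)
    (f : (Fin n → ℝ) → (Fin m → ℝ) → ℂ) (x : Fin n → ℝ) (y : Fin m → ℝ)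
    (hx : ∀ i, 0 < x i) (hy : ∀ j, 0 < y j) :
    MopR n m Q T (BoostOp n m q t f) x y - BoostOp n m q t (MopR n m Q T f) x y =
      ε * Complex.I * MopR n m Q T f x y := by
  have hTε' : Real.log T⁻¹ / Real.log t = -ε := by rw [Real.log_inv, neg_div, hTε]
  simp only [MopR, BoostOp, sum_log_div_update_mul hQ hQε x hx,
    sum_log_div_update_mul (inv_pos.2 hT) hTε' y hy]
  simp only [mul_left_comm _ (_ - _) (f _ _), ← Finset.mul_sum]
  push_cast
  ring

theorem statement7 (n m : ℕ) (q t : ℝ)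
    (hq0 : 0 < q) (hq1 : q < 1) (ht0 : 0 < t) (ht1 : t < 1)
    (f : (Fin n → ℝ) → (Fin m → ℝ) → ℂ) (x : Fin n → ℝ) (y : Fin m → ℝ)
    (hx0 : ∀ i, 0 < x i) (hy0 : ∀ j, 0 < y j)
    (hx : ∀ i i' : Fin n, i ≠ i' → x i ≠ x i')
    (hy : ∀ j j' : Fin m, j ≠ j' → y j ≠ y j')
    (hxy : ∀ (i : Fin n) (j : Fin m), Real.sqrt t * x i ≠ (Real.sqrt q)⁻¹ * y j)
    (hxy' : ∀ (i : Fin n) (j : Fin m), Real.sqrt t⁻¹ * x i ≠ (Real.sqrt q⁻¹)⁻¹ * y j) :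
    MopR n m q t (BoostOp n m q t f) x y - BoostOp n m q t (MopR n m q t f) x y =
        Complex.I * MopR n m q t f x y ∧
      MopR n m q⁻¹ t⁻¹ (BoostOp n m q t f) x y - BoostOp n m q t (MopR n m q⁻¹ t⁻¹ f) x y =
        -Complex.I * MopR n m q⁻¹ t⁻¹ f x y := by
  have hq : Real.log q ≠ 0 := (Real.log_neg hq0 hq1).ne
  have ht : Real.log t ≠ 0 := (Real.log_neg ht0 ht1).ne
  constructor
  · simpa using MopR_BoostOp_sub_BoostOp_MopR n m (ε := 1) hq0 ht0
      (div_self hq) (div_self ht) f x y hx0 hy0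
  · simpa using MopR_BoostOp_sub_BoostOp_MopR n m (ε := -1) (inv_pos.2 hq0) (inv_pos.2 ht0)
      (by rw [Real.log_inv, neg_div, div_self hq]) (by rw [Real.log_inv, neg_div, div_self ht])
      f x y hx0 hy0
end
end

section
/- Let 0 < q < t < 1, and let f(x,y) be a Laurent polynomial in two variables with complex coefficients satisfying the symmetry f(q^{1/2} x, t^{1/2} x) = f(q^{−1/2} x, t^{−1/2} x) for all x ∈ ℂ∖{0}. For ρ,ρ′ > 0 with ρ/ρ′ ∉ {(q/t)^{1/2}, (t/q)^{1/2}}, define I(ρ,ρ′) := ∮_{|x|=ρ} dx/(2πi x) ∮_{|y|=ρ′} dy/(2πi y) f(x,y)/[(1 − q^{−1/2} t^{1/2} x/y)(1 − q^{−1/2} t^{1/2} y/x)]. Then for all ξ,ξ′ > 0 with ξ/ξ′ > q^{−1/2} t^{1/2}, one has I(ξ,ξ′) = I(ξ′,ξ). -/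
open Complex MeasureTheory Finset

noncomputable section

/-- The circle integral `∮_{|z|=ρ} F(z) dz/(2πiz) = (1/2π) ∫_0^{2π} F(ρ e^{iθ}) dθ`. -/
def circleAvg (ρ : ℝ) (F : ℂ → ℂ) : ℂ :=
  (1 / (2 * (Real.pi : ℂ))) *
    ∫ θ in (0 : ℝ)..(2 * Real.pi), F ((ρ : ℂ) * Complex.exp ((θ : ℂ) * Complex.I))

/-- The double contour integral `I(ρ,ρ′)` from the `n = m = 1` case. -/
def I11 (q t : ℝ) (f : ℂ → ℂ → ℂ) (ρ ρ' : ℝ) : ℂ :=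
  circleAvg ρ fun x => circleAvg ρ' fun y =>
    f x y / ((1 - (Real.sqrt q : ℂ)⁻¹ * (Real.sqrt t : ℂ) * (x / y)) *
      (1 - (Real.sqrt q : ℂ)⁻¹ * (Real.sqrt t : ℂ) * (y / x)))


theorem circleAvg_congr {ρ : ℝ} {F G : ℂ → ℂ}
    (h : ∀ θ : ℝ, F (ρ * Complex.exp (θ * Complex.I)) = G (ρ * Complex.exp (θ * Complex.I))) :
    circleAvg ρ F = circleAvg ρ G := by
  unfold circleAvg
  simp_rw [h]

theorem circleAvg_sum_mul {ι : Type*} {ρ : ℝ} (s : Finset ι) (c : ι → ℂ) (F : ι → ℂ → ℂ)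
    (hF : ∀ i ∈ s, Continuous fun θ : ℝ => F i (ρ * Complex.exp (θ * Complex.I))) :
    circleAvg ρ (fun x => ∑ i ∈ s, c i * F i x) = ∑ i ∈ s, c i * circleAvg ρ (F i) := by
  have hcont : ∀ i ∈ s, Continuous fun θ : ℝ => c i * F i (ρ * Complex.exp (θ * Complex.I)) :=
    fun i hi => continuous_const.mul (hF i hi)
  unfold circleAvg
  rw [intervalIntegral.integral_finsetSum fun i hi => (hcont i hi).intervalIntegrable _ _,
    Finset.mul_sum]
  refine Finset.sum_congr rfl fun i _ => ?_
  rw [intervalIntegral.integral_const_mul]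
  ring

/-- The substitution `y = x / u` on a circle, for a fixed `x = ρ e^{iφ}`. -/
theorem circleAvg_comp_div {ρ ρ' : ℝ} (hρ : 0 < ρ) (hρ' : 0 < ρ') (φ : ℝ) (G : ℂ → ℂ) :
    circleAvg (ρ / ρ') (fun u => G (ρ * Complex.exp (φ * Complex.I) / u)) = circleAvg ρ' G := by
  unfold circleAvg
  congr 1
  set h : ℝ → ℂ := fun θ => G (ρ' * Complex.exp (θ * Complex.I)) with hh
  have hper : Function.Periodic h (2 * Real.pi) := fun θ => by
    simp only [hh]
    congr 2
    push_cast
    exact Complex.exp_mul_I_periodic θ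
  have hρc : (ρ : ℂ) ≠ 0 := by exact_mod_cast hρ.ne'
  have hρc' : (ρ' : ℂ) ≠ 0 := by exact_mod_cast hρ'.ne'
  have hcomp : ∀ θ : ℝ, G (ρ * Complex.exp (φ * Complex.I) /
      (((ρ / ρ' : ℝ) : ℂ) * Complex.exp (θ * Complex.I))) = h (φ - θ) := fun θ => by
    simp only [hh]
    congr 1
    push_cast
    rw [sub_mul, Complex.exp_sub]
    have := Complex.exp_ne_zero (θ * Complex.I)
    field_simp
  simp_rw [hcomp]
  rw [intervalIntegral.integral_comp_sub_left h φ]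
  have := hper.intervalIntegral_add_eq (φ - 2 * Real.pi) 0
  simpa using this

theorem circleAvg_zpow (ρ : ℝ) (n : ℤ) :
    circleAvg ρ (fun x => x ^ n) = if n = 0 then 1 else 0 := by
  unfold circleAvg
  have hpi : (Real.pi : ℂ) ≠ 0 := by exact_mod_cast Real.pi_ne_zero
  split_ifs with hn
  · subst hn
    simp
    field_simp
  · have hc : (n : ℂ) * Complex.I ≠ 0 := mul_ne_zero (by exact_mod_cast hn) Complex.I_ne_zero
    have hpow : ∀ θ : ℝ, ((ρ : ℂ) * Complex.exp (θ * Complex.I)) ^ n =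
        (ρ : ℂ) ^ n * Complex.exp (n * Complex.I * θ) := fun θ => by
      rw [mul_zpow, ← Complex.exp_int_mul]
      ring_nf
    simp_rw [hpow]
    rw [intervalIntegral.integral_const_mul, integral_exp_mul_complex hc]
    have h1 : Complex.exp (n * Complex.I * ((2 * Real.pi : ℝ) : ℂ)) = 1 := by
      rw [← Complex.exp_int_mul_two_pi_mul_I n]
      push_cast
      ring_nf
    rw [h1]
    simp

theorem continuous_circle_zpow {ρ : ℝ} (hρ : 0 < ρ) (n : ℤ) :
    Continuous fun θ : ℝ => ((ρ : ℂ) * Complex.exp (θ * Complex.I)) ^ n := by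
  refine Continuous.zpow₀ (by fun_prop) n fun θ => Or.inl ?_
  exact mul_ne_zero (by exact_mod_cast hρ.ne') (Complex.exp_ne_zero _)

/-- The moment `∮_{|u|=r} u^m / ((1 - a u)(1 - a u⁻¹)) du/(2πiu)`. -/
def kernelMoment (a : ℂ) (r : ℝ) (m : ℤ) : ℂ :=
  circleAvg r fun u => u ^ m * ((1 - a * u) * (1 - a * u⁻¹))⁻¹

theorem kernel_denom_ne_zero {a r : ℝ} (ha : 1 < a) (hr : 0 < r) (h1 : a * r ≠ 1) (h2 : r ≠ a)
    (θ : ℝ) :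
    (1 - (a : ℂ) * (r * Complex.exp (θ * Complex.I))) *
      (1 - (a : ℂ) * ((r : ℂ) * Complex.exp (θ * Complex.I))⁻¹) ≠ 0 := by
  have hnorm : ‖(r : ℂ) * Complex.exp (θ * Complex.I)‖ = r := by
    rw [norm_mul, Complex.norm_exp_ofReal_mul_I, Complex.norm_real, Real.norm_of_nonneg hr.le,
      mul_one]
  have hanorm : ‖(a : ℂ)‖ = a := by
    rw [Complex.norm_real, Real.norm_of_nonneg (by linarith)]
  refine mul_ne_zero (fun h => h1 ?_) (fun h => h2 ?_)
  · have := congrArg norm (sub_eq_zero.mp h)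
    rw [norm_mul, hnorm, hanorm, norm_one] at this
    exact this.symm
  · have := congrArg norm (sub_eq_zero.mp h)
    rw [norm_mul, norm_inv, hnorm, hanorm, norm_one] at this
    field_simp at this
    exact this

theorem continuous_kernelMoment_integrand {a r : ℝ} (ha : 1 < a) (hr : 0 < r) (h1 : a * r ≠ 1)
    (h2 : r ≠ a) (m : ℤ) :
    Continuous fun θ : ℝ => ((r : ℂ) * Complex.exp (θ * Complex.I)) ^ m *
      ((1 - (a : ℂ) * (r * Complex.exp (θ * Complex.I))) *
        (1 - (a : ℂ) * ((r : ℂ) * Complex.exp (θ * Complex.I))⁻¹))⁻¹ := by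
  refine (continuous_circle_zpow hr m).mul (Continuous.inv₀ ?_ (kernel_denom_ne_zero ha hr h1 h2))
  have hinv := continuous_circle_zpow hr (-1)
  simp only [zpow_neg_one] at hinv
  fun_prop

theorem kernelMoment_inv {r : ℝ} (a : ℂ) (hr : 0 < r) (m : ℤ) :
    kernelMoment a r⁻¹ m = kernelMoment a r (-m) := by
  have h := circleAvg_comp_div one_pos hr 0
    (fun u => u ^ (-m) * ((1 - a * u) * (1 - a * u⁻¹))⁻¹)
  unfold kernelMoment
  rw [← h, one_div]
  refine circleAvg_congr fun θ => ?_
  generalize ((r⁻¹ : ℝ) : ℂ) * Complex.exp (θ * Complex.I) = u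
  simp only [Complex.ofReal_one, Complex.ofReal_zero, zero_mul, Complex.exp_zero, one_mul,
    one_div, inv_zpow', neg_neg, inv_inv, mul_comm (1 - a * u)]

theorem kernelMoment_recurrence {a r : ℝ} (ha : 1 < a) (hr : 0 < r) (h1 : a * r ≠ 1)
    (h2 : r ≠ a) (m : ℤ) :
    kernelMoment a r (m + 1) + kernelMoment a r (m - 1) - (a + (a : ℂ)⁻¹) * kernelMoment a r m =
      -(a : ℂ)⁻¹ * if m = 0 then 1 else 0 := by
  have hac : (a : ℂ) ≠ 0 := by exact_mod_cast (by linarith : a ≠ 0)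
  have hsum := circleAvg_sum_mul (ρ := r) Finset.univ ![1, 1, -(a + (a : ℂ)⁻¹)]
    (fun (i : Fin 3) u => u ^ (![m + 1, m - 1, m] i) * ((1 - (a : ℂ) * u) * (1 - a * u⁻¹))⁻¹)
    (fun i _ => continuous_kernelMoment_integrand ha hr h1 h2 _)
  have hconst := circleAvg_sum_mul (ρ := r) {m} (fun _ => -(a : ℂ)⁻¹) (fun i u => u ^ i)
    (fun i _ => continuous_circle_zpow hr i)
  simp only [Finset.sum_singleton, circleAvg_zpow r] at hconst
  rw [← hconst]
  simp only [Fin.sum_univ_three, Matrix.cons_val_zero, Matrix.cons_val_one, Matrix.cons_val] at hsum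
  unfold kernelMoment
  rw [sub_eq_add_neg, ← neg_mul]
  refine Eq.trans ?_ (hsum.symm.trans (circleAvg_congr fun θ => ?_))
  · ring
  · have hd := kernel_denom_ne_zero ha hr h1 h2 θ
    have hu : (r : ℂ) * Complex.exp (θ * Complex.I) ≠ 0 :=
      mul_ne_zero (by exact_mod_cast hr.ne') (Complex.exp_ne_zero _)
    generalize (r : ℂ) * Complex.exp (θ * Complex.I) = u at hd hu ⊢
    rw [zpow_add_one₀ hu, zpow_sub_one₀ hu]
    generalize u ^ m = p
    generalize hD : (1 - (a : ℂ) * u) * (1 - a * u⁻¹) = D at hd ⊢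
    have key : u + u⁻¹ - (a + (a : ℂ)⁻¹) = -(a : ℂ)⁻¹ * D := by
      rw [← hD]
      field_simp
      ring
    calc _ = p * (u + u⁻¹ - (a + (a : ℂ)⁻¹)) * D⁻¹ := by ring
      _ = _ := by rw [key]; field_simp

theorem eq_mul_of_recurrence {a : ℂ} (ha : a ≠ 0) {D : ℤ → ℂ} (h0 : D 0 = 0)
    (hD : ∀ m, D (m + 1) + D (m - 1) - (a + a⁻¹) * D m = 0) (m : ℤ) :
    (a - a⁻¹) * D m = D 1 * (a ^ m - a ^ (-m)) := by
  suffices h : (a - a⁻¹) * D m = D 1 * (a ^ m - a ^ (-m)) ∧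
      (a - a⁻¹) * D (m + 1) = D 1 * (a ^ (m + 1) - a ^ (-(m + 1))) from h.1
  have hpow : ∀ m : ℤ, a ^ (m + 1) + a ^ (m - 1) = (a + a⁻¹) * a ^ m := fun m => by
    rw [zpow_add_one₀ ha, zpow_sub_one₀ ha]
    ring
  have hE : ∀ m : ℤ, (a ^ (m + 1) - a ^ (-(m + 1))) + (a ^ (m - 1) - a ^ (-(m - 1))) -
      (a + a⁻¹) * (a ^ m - a ^ (-m)) = 0 := fun m => by
    have h1 := hpow m
    have h2 := hpow (-m)
    rw [show -m + 1 = -(m - 1) by ring, show -m - 1 = -(m + 1) by ring] at h2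
    linear_combination h1 - h2
  induction m using Int.induction_on with
  | zero => simp [h0, mul_comm]
  | succ k ih =>
    refine ⟨ih.2, ?_⟩
    have h1 := hD (k + 1)
    have h2 := hE (k + 1)
    rw [add_sub_cancel_right] at h1 h2
    linear_combination (a - a⁻¹) * h1 - D 1 * h2 + (a + a⁻¹) * ih.2 - ih.1
  | pred k ih =>
    rw [sub_add_cancel]
    refine ⟨?_, ih.1⟩
    have h1 := hD (-k)
    have h2 := hE (-k)
    linear_combination (a - a⁻¹) * h1 - D 1 * h2 + (a + a⁻¹) * ih.1 - ih.2

theorem kernelMoment_sub_inv {a r : ℝ} (ha : 1 < a) (hr : 0 < r) (h1 : a * r ≠ 1) (h2 : r ≠ a)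
    (m : ℤ) :
    ((a : ℂ) - (a : ℂ)⁻¹) * (kernelMoment a r m - kernelMoment a r⁻¹ m) =
      (kernelMoment a r 1 - kernelMoment a r⁻¹ 1) * ((a : ℂ) ^ m - (a : ℂ) ^ (-m)) := by
  have hac : (a : ℂ) ≠ 0 := by exact_mod_cast (by linarith : a ≠ 0)
  refine eq_mul_of_recurrence (D := fun m => kernelMoment a r m - kernelMoment a r⁻¹ m) hac
    ?_ (fun m => ?_) m
  · simp [kernelMoment_inv _ hr]
  · simp only [kernelMoment_inv _ hr]
    have e1 := kernelMoment_recurrence ha hr h1 h2 m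
    have e2 := kernelMoment_recurrence ha hr h1 h2 (-m)
    rw [show -m + 1 = -(m - 1) by ring, show -m - 1 = -(m + 1) by ring] at e2
    simp only [neg_eq_zero] at e2
    linear_combination e1 - e2

theorem I11_eq_sum {q t a : ℝ} (hqt : (Real.sqrt q)⁻¹ * Real.sqrt t = a) {f : ℂ → ℂ → ℂ}
    {c : ℤ × ℤ →₀ ℂ} (hf : ∀ x y : ℂ, f x y = c.sum fun k a => a * x ^ k.1 * y ^ k.2)
    {ρ ρ' : ℝ} (hρ : 0 < ρ) (hρ' : 0 < ρ') (ha : 1 < a) (h1 : a * (ρ / ρ') ≠ 1)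
    (h2 : ρ / ρ' ≠ a) :
    I11 q t f ρ ρ' = ∑ k ∈ c.support,
      c k * kernelMoment a (ρ / ρ') (-k.2) * if k.1 + k.2 = 0 then 1 else 0 := by
  have hr : 0 < ρ / ρ' := div_pos hρ hρ'
  unfold I11
  simp_rw [← circleAvg_zpow ρ]
  rw [← circleAvg_sum_mul _ _ _ fun k _ => continuous_circle_zpow hρ _]
  refine circleAvg_congr fun φ => ?_
  have hx : (ρ : ℂ) * Complex.exp (φ * Complex.I) ≠ 0 :=
    mul_ne_zero (by exact_mod_cast hρ.ne') (Complex.exp_ne_zero _)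
  rw [← circleAvg_comp_div hρ hρ' φ]
  generalize (ρ : ℂ) * Complex.exp (φ * Complex.I) = x at hx ⊢
  have hsum := circleAvg_sum_mul (ρ := ρ / ρ') c.support (fun k => c k * x ^ (k.1 + k.2))
    (fun k u => u ^ (-k.2) * ((1 - (a : ℂ) * u) * (1 - a * u⁻¹))⁻¹)
    (fun k _ => continuous_kernelMoment_integrand ha hr h1 h2 _)
  refine Eq.trans (circleAvg_congr fun θ => ?_) (hsum.trans (Finset.sum_congr rfl fun k _ => ?_))
  · have hu : ((ρ / ρ' : ℝ) : ℂ) * Complex.exp (θ * Complex.I) ≠ 0 :=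
      mul_ne_zero (by exact_mod_cast hr.ne') (Complex.exp_ne_zero _)
    generalize ((ρ / ρ' : ℝ) : ℂ) * Complex.exp (θ * Complex.I) = u at hu ⊢
    have e1 : x / (x / u) = u := by field_simp
    have e2 : x / u / x = u⁻¹ := by field_simp
    have e3 : (Real.sqrt q : ℂ)⁻¹ * (Real.sqrt t : ℂ) = a := by rw [← hqt]; push_cast; rfl
    rw [e1, e2, e3, hf, Finsupp.sum, div_eq_mul_inv, Finset.sum_mul]
    refine Finset.sum_congr rfl fun k _ => ?_
    rw [div_zpow, zpow_add₀ hx, zpow_neg]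
    ring
  · unfold kernelMoment
    ring

/-- Constant-term extraction from the diagonal symmetry of a Laurent polynomial. -/
theorem sum_eq_zero_of_diagonal_symm {f : ℂ → ℂ → ℂ} {c : ℤ × ℤ →₀ ℂ} {s w : ℂ}
    (hf : ∀ x y : ℂ, f x y = c.sum fun k a => a * x ^ k.1 * y ^ k.2)
    (hsym : ∀ x : ℂ, x ≠ 0 → f (s * x) (w * x) = f (s⁻¹ * x) (w⁻¹ * x)) :
    ∑ k ∈ c.support, c k * ((s⁻¹ * w) ^ (-k.2) - (s⁻¹ * w) ^ (- -k.2)) *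
      (if k.1 + k.2 = 0 then 1 else 0) = 0 := by
  have havg : ∀ s w : ℂ, circleAvg 1 (fun x => f (s * x) (w * x)) = ∑ k ∈ c.support,
      c k * (s ^ k.1 * w ^ k.2) * if k.1 + k.2 = 0 then 1 else 0 := fun s w => by
    simp_rw [← circleAvg_zpow 1]
    rw [← circleAvg_sum_mul _ _ _ fun k _ => continuous_circle_zpow one_pos _]
    refine circleAvg_congr fun θ => ?_
    have hx : ((1 : ℝ) : ℂ) * Complex.exp (θ * Complex.I) ≠ 0 := by
      simp [Complex.exp_ne_zero]
    generalize ((1 : ℝ) : ℂ) * Complex.exp (θ * Complex.I) = x at hx ⊢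
    rw [hf, Finsupp.sum]
    refine Finset.sum_congr rfl fun k _ => ?_
    rw [mul_zpow, mul_zpow, zpow_add₀ hx]
    ring
  have heq : circleAvg 1 (fun x => f (s⁻¹ * x) (w⁻¹ * x)) =
      circleAvg 1 (fun x => f (s * x) (w * x)) :=
    circleAvg_congr fun θ => (hsym _ (by simp [Complex.exp_ne_zero])).symm
  rw [havg, havg, ← sub_eq_zero, ← Finset.sum_sub_distrib] at heq
  refine Eq.trans (Finset.sum_congr rfl fun k _ => ?_) heq
  split_ifs with hk
  · rw [show k.1 = -k.2 by omega]
    simp only [mul_zpow, zpow_neg, inv_zpow, mul_inv, inv_inv, mul_one]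
    ring
  · simp

theorem statement9 (q t : ℝ) (hq0 : 0 < q) (hqt : q < t) (ht1 : t < 1)
    (f : ℂ → ℂ → ℂ)
    (hf : ∃ c : ℤ × ℤ →₀ ℂ, ∀ x y : ℂ, f x y = c.sum fun k a => a * x ^ k.1 * y ^ k.2)
    (hsym : ∀ x : ℂ, x ≠ 0 →
      f ((Real.sqrt q : ℂ) * x) ((Real.sqrt t : ℂ) * x) =
        f ((Real.sqrt q : ℂ)⁻¹ * x) ((Real.sqrt t : ℂ)⁻¹ * x)) :
    ∀ ξ ξ' : ℝ, 0 < ξ → 0 < ξ' → ξ / ξ' > (Real.sqrt q)⁻¹ * Real.sqrt t →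
      I11 q t f ξ ξ' = I11 q t f ξ' ξ := by
  intro ξ ξ' hξ hξ' hlt
  obtain ⟨c, hc⟩ := hf
  have hs : 0 < Real.sqrt q := Real.sqrt_pos.mpr hq0
  obtain ⟨a, ha⟩ : ∃ a, (Real.sqrt q)⁻¹ * Real.sqrt t = a := ⟨_, rfl⟩
  have ha1 : 1 < a := by
    rw [← ha, inv_mul_eq_div, one_lt_div hs]
    exact Real.sqrt_lt_sqrt hq0.le hqt
  rw [ha] at hlt
  have hr : 0 < ξ / ξ' := div_pos hξ hξ'
  have h1 : a * (ξ / ξ') ≠ 1 := by nlinarith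
  have hinv : ξ' / ξ = (ξ / ξ')⁻¹ := (inv_div ξ ξ').symm
  have h1' : a * (ξ' / ξ) ≠ 1 := by
    rw [hinv]
    intro h
    field_simp at h
    rw [gt_iff_lt, lt_div_iff₀ hξ'] at hlt
    linarith
  have h2' : ξ' / ξ ≠ a := by
    rw [hinv]
    intro h
    rw [← h] at h1
    exact h1 (inv_mul_cancel₀ hr.ne')
  have hac : (a : ℂ) - (a : ℂ)⁻¹ ≠ 0 := by
    have : a⁻¹ < 1 := inv_lt_one_of_one_lt₀ ha1
    exact_mod_cast (by linarith : a - a⁻¹ ≠ 0)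
  have hzero := sum_eq_zero_of_diagonal_symm hc hsym
  rw [show (Real.sqrt q : ℂ)⁻¹ * (Real.sqrt t : ℂ) = a by rw [← ha]; push_cast; rfl] at hzero
  rw [I11_eq_sum ha hc hξ hξ' ha1 h1 hlt.ne', I11_eq_sum ha hc hξ' hξ ha1 h1' h2', hinv,
    ← sub_eq_zero, ← Finset.sum_sub_distrib]
  refine (mul_eq_zero.mp ?_).resolve_left hac
  replace hzero := congrArg
    ((kernelMoment a (ξ / ξ') 1 - kernelMoment a (ξ / ξ')⁻¹ 1) * ·) hzero
  simp only [Finset.mul_sum, mul_zero] at hzero ⊢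
  refine Eq.trans (Finset.sum_congr rfl fun k _ => ?_) hzero
  linear_combination (c k * if k.1 + k.2 = 0 then 1 else 0) *
    kernelMoment_sub_inv ha1 hr h1 hlt.ne' (-k.2)
end
end
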